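/- Stolarsky's invariance principle: for every d ≥ 1 there exists a constant C_d > 0 such that for every N and every N-point set X_N = {x_1, ..., x_N} ⊂ S^d, (1/N²) Σ_{i=1}^{N} Σ_{j=1}^{N} ‖x_i - x_j‖ + (1/C_d) · [D_{L²}(X_N)]² = ∫_{S^d} ∫_{S^d} ‖x - y‖ dσ_d(x) dσ_d(y); in particular the left-hand side is independent of the choice of X_N. -/

import Mathlib

open MeasureTheory
open scoped RealInnerProductSpace

/-- The normalised surface area measure `σ_d` on the unit sphere `S^d ⊂ ℝ^{d+1}`. -/
noncomputable def sphereMeasure (d : ℕ) :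
    Measure (EuclideanSpace ℝ (Fin (d + 1))) :=
  (μH[(d : ℝ)] (Metric.sphere (0 : EuclideanSpace ℝ (Fin (d + 1))) 1))⁻¹ •
    (μH[(d : ℝ)]).restrict (Metric.sphere (0 : EuclideanSpace ℝ (Fin (d + 1))) 1)

/-- The squared spherical cap `L²`-discrepancy of the point set `x_1, …, x_N` on `S^d`:
`[D_{L²}]² = ∫_0^π ∫_{S^d} |(1/N) Σ_j 1_{x_j ∈ C(z,θ)} - σ_d(C(z,θ))|² dσ_d(z) sin θ dθ`. -/
noncomputable def capL2DiscrepancySq (d N : ℕ)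
    (x : Fin N → EuclideanSpace ℝ (Fin (d + 1))) : ℝ :=
  ∫ θ in (0 : ℝ)..Real.pi,
    (∫ z, ((N : ℝ)⁻¹ * ∑ j : Fin N, (if Real.cos θ < ⟪x j, z⟫ then (1 : ℝ) else 0) -
        (sphereMeasure d {w | Real.cos θ < ⟪w, z⟫}).toReal) ^ 2 ∂(sphereMeasure d)) *
      Real.sin θ

namespace Stolarsky

abbrev E (d : ℕ) := EuclideanSpace ℝ (Fin (d + 1))

lemma hausdorff_fin (d : ℕ) : (μH[(d : ℝ)] : Measure (Fin d → ℝ)) = volume := by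
  have := hausdorffMeasure_pi_real (ι := Fin d)
  rwa [Fintype.card_fin] at this

/-- The sphere has positive `d`-dimensional Hausdorff measure. -/
lemma hausdorff_sphere_pos (d : ℕ) :
    μH[(d : ℝ)] (Metric.sphere (0 : E d) 1) ≠ 0 := by
  intro h0
  let f : E d → (Fin d → ℝ) := fun z j => z j.succ
  have hf : LipschitzWith 1 f := by
    refine LipschitzWith.of_dist_le_mul fun x y => ?_
    rw [NNReal.coe_one, one_mul, dist_pi_le_iff dist_nonneg]
    intro j
    rw [dist_eq_norm x y, Real.dist_eq]
    have := PiLp.norm_apply_le (x - y) j.succ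
    simpa [f] using this
  have h1 := hf.hausdorffMeasure_image_le (Nat.cast_nonneg d) (Metric.sphere (0 : E d) 1)
  rw [h0, mul_zero, hausdorff_fin] at h1
  let U : Set (Fin d → ℝ) := {u | ∑ j, u j ^ 2 < 1}
  have hU : IsOpen U := isOpen_lt (by fun_prop) continuous_const
  have hUn : U.Nonempty := ⟨0, by simp [U]⟩
  have hsub : U ⊆ f '' Metric.sphere (0 : E d) 1 := by
    intro u hu
    have hu' : ∑ j, u j ^ 2 < 1 := hu
    refine ⟨WithLp.toLp 2 (Fin.cons (Real.sqrt (1 - ∑ j, u j ^ 2)) u), ?_, ?_⟩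
    · rw [mem_sphere_zero_iff_norm, EuclideanSpace.norm_eq, Fin.sum_univ_succ]
      simp [Real.sq_sqrt (sub_nonneg.2 hu'.le)]
    · ext j
      simp [f]
  have h2 := hU.measure_pos volume hUn
  exact absurd (lt_of_lt_of_le h2 ((measure_mono hsub).trans h1)) (lt_irrefl _)

/-- The sphere has finite `d`-dimensional Hausdorff measure. -/
lemma hausdorff_sphere_ne_top (d : ℕ) :
    μH[(d : ℝ)] (Metric.sphere (0 : E d) 1) ≠ ⊤ := by
  let h : Fin (d + 1) → ℝ → (Fin d → ℝ) → E d := fun i s u => WithLp.toLp 2 (i.insertNth s u)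
  let g : Fin (d + 1) → ℝ → (Fin d → ℝ) → E d := fun i s u => (‖h i s u‖)⁻¹ • h i s u
  let Q : Set (Fin d → ℝ) := Set.Icc (fun _ => -1) (fun _ => 1)
  have hh : ∀ i s, ContDiff ℝ 1 (h i s) := by
    intro i s
    rw [contDiff_euclidean]
    intro k
    refine Fin.succAboveCases i ?_ (fun j => ?_) k
    · simp only [h, Fin.insertNth_apply_same]
      exact contDiff_const
    · simp only [h, Fin.insertNth_apply_succAbove]
      exact contDiff_apply ℝ ℝ j
  have hne : ∀ i s u, s ≠ 0 → h i s u ≠ 0 := by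
    intro i s u hs h0
    have : (h i s u) i = 0 := by rw [h0]; rfl
    simp [h] at this
    exact hs this
  have hg : ∀ i s, s ≠ 0 → μH[(d : ℝ)] (g i s '' Q) < ⊤ := by
    intro i s hs
    have hc : ContDiff ℝ 1 (g i s) :=
      (((hh i s).norm ℝ (fun u => hne i s u hs)).inv
        (fun u => norm_ne_zero_iff.2 (hne i s u hs))).smul (hh i s)
    obtain ⟨K, hK⟩ := hc.contDiffOn.exists_lipschitzOnWith one_ne_zero (convex_Icc _ _)
      (isCompact_Icc : IsCompact Q)
    refine (hK.hausdorffMeasure_image_le (Nat.cast_nonneg d)).trans_lt ?_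
    rw [hausdorff_fin]
    exact ENNReal.mul_lt_top (ENNReal.rpow_lt_top_of_nonneg (Nat.cast_nonneg d) ENNReal.coe_ne_top)
      (isCompact_Icc : IsCompact Q).measure_lt_top
  have hsub : Metric.sphere (0 : E d) 1 ⊆ ⋃ i, (g i 1 '' Q ∪ g i (-1) '' Q) := by
    intro z hz
    rw [mem_sphere_zero_iff_norm] at hz
    obtain ⟨i, hi⟩ := Finite.exists_max (fun i => |z i|)
    have hm : 0 < |z i| := by
      by_contra hcon
      have : z = 0 := by
        ext k
        have := (hi k).trans (not_lt.1 hcon)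
        simpa using this
      rw [this] at hz
      simp at hz
    have key : z = g i (z i / |z i|) (fun j => z (i.succAbove j) / |z i|) := by
      have e : h i (z i / |z i|) (fun j => z (i.succAbove j) / |z i|) = (|z i|)⁻¹ • z := by
        ext k
        refine Fin.succAboveCases i ?_ (fun j => ?_) k
        · simp [h, div_eq_inv_mul]
        · simp [h, div_eq_inv_mul]
      simp only [g]
      rw [e, norm_smul, hz, norm_inv, Real.norm_eq_abs, abs_abs, mul_one, inv_inv, smul_smul,
        mul_inv_cancel₀ hm.ne', one_smul]
    have hQ : (fun j => z (i.succAbove j) / |z i|) ∈ Q := by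
      refine ⟨fun j => ?_, fun j => ?_⟩
      · have := abs_le.1 (hi (i.succAbove j))
        show -1 ≤ z (i.succAbove j) / |z i|
        rw [le_div_iff₀ hm]; linarith
      · have := abs_le.1 (hi (i.succAbove j))
        show z (i.succAbove j) / |z i| ≤ 1
        rw [div_le_iff₀ hm]; linarith
    refine Set.mem_iUnion.2 ⟨i, ?_⟩
    rcases lt_or_gt_of_ne (abs_pos.1 hm) with hlt | hgt
    · right
      refine ⟨_, hQ, ?_⟩
      rw [abs_of_neg hlt] at key ⊢
      rw [div_neg, div_self hlt.ne] at key
      exact key.symm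
    · left
      refine ⟨_, hQ, ?_⟩
      rw [abs_of_pos hgt] at key ⊢
      rw [div_self hgt.ne'] at key
      exact key.symm
  refine ((measure_mono hsub).trans_lt ?_).ne
  refine (measure_iUnion_fintype_le _ _).trans_lt ?_
  rw [ENNReal.sum_lt_top]
  intro i _
  exact (measure_union_le _ _).trans_lt
    (ENNReal.add_lt_top.2 ⟨hg i 1 one_ne_zero, hg i (-1) (by norm_num)⟩)

instance (d : ℕ) : IsProbabilityMeasure (sphereMeasure d) := by
  constructor
  rw [sphereMeasure, Measure.smul_apply, Measure.restrict_apply_univ, smul_eq_mul]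
  exact ENNReal.inv_mul_cancel (hausdorff_sphere_pos d) (hausdorff_sphere_ne_top d)

lemma ae_norm (d : ℕ) : ∀ᵐ z ∂(sphereMeasure d), ‖z‖ = 1 := by
  rw [sphereMeasure]
  apply Measure.ae_smul_measure
  filter_upwards [ae_restrict_mem (Metric.isClosed_sphere.measurableSet)] with z hz
  simpa using hz

lemma mp (d : ℕ) (U : E d ≃ₗᵢ[ℝ] E d) :
    MeasurePreserving U (sphereMeasure d) (sphereMeasure d) := by
  have h := U.toIsometryEquiv.measurePreserving_hausdorffMeasure (d : ℝ)
  have h2 := h.restrict_preimage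
    (Metric.isClosed_sphere (x := (0 : E d)) (ε := 1)).measurableSet
  have e : (U.toIsometryEquiv ⁻¹' Metric.sphere (0 : E d) 1) = Metric.sphere (0 : E d) 1 := by
    ext z
    simp
  rw [e] at h2
  exact h2.smul_measure _

/-- Rotation invariance of zonal integrals. -/
lemma integral_zonal (d : ℕ) (f : ℝ → ℝ) {a b : E d} (hab : ‖a‖ = ‖b‖) :
    ∫ z, f ⟪a, z⟫ ∂(sphereMeasure d) = ∫ z, f ⟪b, z⟫ ∂(sphereMeasure d) := by
  let U : E d ≃ₗᵢ[ℝ] E d := (ℝ ∙ (a - b))ᗮ.reflection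
  have hU : U a = b := Submodule.reflection_sub hab
  have := (mp d U).integral_comp U.toHomeomorph.measurableEmbedding (fun z => f ⟪b, z⟫)
  rw [← this]
  simp only [← hU, LinearIsometryEquiv.inner_map_map]

end Stolarsky

namespace Stolarsky

/-- Indicator of the cap of centre `a` and height `t`. -/
noncomputable def ind {d : ℕ} (t : ℝ) (a z : E d) : ℝ := if t < ⟪a, z⟫ then (1 : ℝ) else 0

lemma ind_nonneg {d : ℕ} (t : ℝ) (a z : E d) : 0 ≤ ind t a z := by
  unfold ind; split_ifs <;> norm_num

lemma ind_le_one {d : ℕ} (t : ℝ) (a z : E d) : ind t a z ≤ 1 := by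
  unfold ind; split_ifs <;> norm_num

lemma measurable_ind_comp {d : ℕ} {α : Type*} [MeasurableSpace α] {f : α → ℝ} {g h : α → E d}
    (hf : Measurable f) (hg : Measurable g) (hh : Measurable h) :
    Measurable (fun x => ind (f x) (g x) (h x)) := by
  unfold ind
  exact Measurable.ite (measurableSet_lt hf (hg.inner hh)) measurable_const measurable_const

lemma norm_ind_mul_le {d : ℕ} (t : ℝ) (a z b w : E d) : ‖ind t a z * ind t b w‖ ≤ 1 := by
  rw [Real.norm_eq_abs, abs_of_nonneg (mul_nonneg (ind_nonneg _ _ _) (ind_nonneg _ _ _))]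
  exact mul_le_one₀ (ind_le_one _ _ _) (ind_nonneg _ _ _) (ind_le_one _ _ _)

/-- The pole. -/
noncomputable def pole (d : ℕ) : E d := EuclideanSpace.single 0 1

lemma norm_pole (d : ℕ) : ‖pole d‖ = 1 := by simp [pole]

/-- The mean of `|⟪e, z⟫|`. -/
noncomputable def cst (d : ℕ) : ℝ := ∫ z, |⟪pole d, z⟫| ∂(sphereMeasure d)

lemma integral_abs_inner (d : ℕ) (v : E d) :
    ∫ z, |⟪v, z⟫| ∂(sphereMeasure d) = cst d * ‖v‖ := by
  have h := integral_zonal d (fun s => |s|) (a := v) (b := ‖v‖ • pole d)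
    (by rw [norm_smul, norm_pole, mul_one, norm_norm])
  rw [h]
  simp only [inner_smul_left, abs_mul, cst]
  rw [integral_const_mul, mul_comm]
  simp

lemma integral_inner_zero (d : ℕ) (v : E d) :
    ∫ z, ⟪v, z⟫ ∂(sphereMeasure d) = 0 := by
  have h := integral_zonal d (fun s => s) (a := v) (b := -v) (by simp)
  simp only [inner_neg_left, integral_neg] at h
  linarith

lemma integrable_inner (d : ℕ) (v : E d) :
    Integrable (fun z => ⟪v, z⟫) (sphereMeasure d) := by
  refine Integrable.of_bound (C := ‖v‖) (by fun_prop) ?_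
  filter_upwards [ae_norm d] with z hz
  have := abs_real_inner_le_norm v z
  rwa [hz, mul_one] at this

lemma cst_pos (d : ℕ) : 0 < cst d := by
  have h1 : ∫ z, ‖z‖ ∂(sphereMeasure d) = 1 := by
    rw [integral_congr_ae (g := fun _ => (1 : ℝ)) (ae_norm d)]
    simp
  have h2 : ∫ z, ‖z‖ ∂(sphereMeasure d) ≤
      ∫ z, ∑ i : Fin (d + 1), |⟪(EuclideanSpace.single i (1 : ℝ) : E d), z⟫|
        ∂(sphereMeasure d) := by
    refine integral_mono_ae ?_ ?_ (Filter.Eventually.of_forall fun z => ?_)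
    · refine Integrable.of_bound (C := 1) (by fun_prop) ?_
      filter_upwards [ae_norm d] with z hz
      simp [hz]
    · exact integrable_finsetSum _ fun i _ => (integrable_inner d _).abs
    · show ‖z‖ ≤ ∑ i : Fin (d + 1), |⟪(EuclideanSpace.single i (1 : ℝ) : E d), z⟫|
      have hz : z = ∑ i, z i • (EuclideanSpace.single i (1 : ℝ) : E d) := by
        ext k
        simp [Finset.sum_apply, Pi.single_apply]
      calc ‖z‖ = ‖∑ i, z i • (EuclideanSpace.single i (1 : ℝ) : E d)‖ := by rw [← hz]
        _ ≤ ∑ i, ‖z i • (EuclideanSpace.single i (1 : ℝ) : E d)‖ := norm_sum_le _ _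
        _ = _ := by
          refine Finset.sum_congr rfl fun i _ => ?_
          simp [norm_smul, EuclideanSpace.inner_single_left]
  rw [integral_finsetSum _ (fun i _ => (integrable_inner d _).abs)] at h2
  simp only [integral_abs_inner] at h2
  rw [h1] at h2
  by_contra hc
  have : ∑ i : Fin (d + 1), cst d * ‖(EuclideanSpace.single i (1 : ℝ) : E d)‖ ≤ 0 :=
    Finset.sum_nonpos fun i _ => mul_nonpos_of_nonpos_of_nonneg (not_lt.1 hc) (norm_nonneg _)
  linarith

lemma integral_ind_ind {d : ℕ} {a z b w : E d} (ha : ‖a‖ = 1) (hz : ‖z‖ = 1) (hb : ‖b‖ = 1)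
    (hw : ‖w‖ = 1) :
    ∫ t in Set.Icc (-1 : ℝ) 1, ind t a z * ind t b w =
      1 + (⟪a, z⟫ + ⟪b, w⟫ - |⟪a, z⟫ - ⟪b, w⟫|) / 2 := by
  have h1 := abs_real_inner_le_norm a z
  have h2 := abs_real_inner_le_norm b w
  rw [ha, hz, one_mul] at h1
  rw [hb, hw, one_mul] at h2
  have e : (fun t => ind t a z * ind t b w) =
      (Set.Iio (min ⟪a, z⟫ ⟪b, w⟫)).indicator (fun _ => (1 : ℝ)) := by
    funext t
    simp only [ind, Set.indicator, Set.mem_Iio, lt_min_iff]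
    split_ifs <;> simp_all
  rw [e, integral_indicator measurableSet_Iio, Measure.restrict_restrict measurableSet_Iio]
  have e2 : Set.Iio (min ⟪a, z⟫ ⟪b, w⟫) ∩ Set.Icc (-1 : ℝ) 1 = Set.Ico (-1) (min ⟪a, z⟫ ⟪b, w⟫) := by
    ext t
    simp only [Set.mem_inter_iff, Set.mem_Iio, Set.mem_Icc, Set.mem_Ico]
    constructor
    · rintro ⟨h, h', _⟩; exact ⟨h', h⟩
    · rintro ⟨h, h'⟩
      exact ⟨h', h, (h'.le.trans (min_le_left _ _)).trans (abs_le.1 h1).2⟩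
  have hm : -1 ≤ min ⟪a, z⟫ ⟪b, w⟫ := le_min (abs_le.1 h1).1 (abs_le.1 h2).1
  rw [e2]
  simp only [integral_const, smul_eq_mul, mul_one, measureReal_restrict_apply_univ,
    Real.volume_real_Ico_of_le hm]
  rcases le_total ⟪a, z⟫ ⟪b, w⟫ with hle | hle
  · rw [min_eq_left hle, abs_of_nonpos (sub_nonpos.2 hle)]
    ring
  · rw [min_eq_right hle, abs_of_nonneg (sub_nonneg.2 hle)]
    ring

lemma kernel_integral {d : ℕ} {x y : E d} (hx : ‖x‖ = 1) (hy : ‖y‖ = 1) :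
    ∫ t in Set.Icc (-1 : ℝ) 1, ∫ z, ind t x z * ind t y z ∂(sphereMeasure d) =
      1 - cst d / 2 * ‖x - y‖ := by
  rw [integral_integral_swap]
  · have : ∀ᵐ z ∂(sphereMeasure d), (∫ t in Set.Icc (-1 : ℝ) 1, ind t x z * ind t y z) =
        1 + (⟪x, z⟫ + ⟪y, z⟫ - |⟪x - y, z⟫|) / 2 := by
      filter_upwards [ae_norm d] with z hz
      rw [integral_ind_ind hx hz hy hz, inner_sub_left]
    rw [integral_congr_ae this, integral_add (integrable_const _), integral_div, integral_sub,
      integral_add (integrable_inner d _) (integrable_inner d _), integral_abs_inner,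
      integral_inner_zero, integral_inner_zero]
    · simp; ring
    · exact (integrable_inner d _).add (integrable_inner d _)
    · exact (integrable_inner d _).abs
    · exact (((integrable_inner d _).add (integrable_inner d _)).sub
        (integrable_inner d _).abs).div_const _
  · refine Integrable.of_bound (C := 1) ?_ (Filter.Eventually.of_forall fun p => ?_)
    · exact ((measurable_ind_comp measurable_fst measurable_const measurable_snd).mul
        (measurable_ind_comp measurable_fst measurable_const measurable_snd)).aestronglyMeasurable
    · exact norm_ind_mul_le _ _ _ _ _

/-- The measure of a cap of height `t`. -/
noncomputable def V (d : ℕ) (t : ℝ) : ℝ := ∫ w, ind t (pole d) w ∂(sphereMeasure d)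

lemma integral_ind {d : ℕ} (t : ℝ) {a : E d} (ha : ‖a‖ = 1) :
    ∫ w, ind t a w ∂(sphereMeasure d) = V d t :=
  integral_zonal d (fun s => if t < s then (1 : ℝ) else 0) (ha.trans (norm_pole d).symm)

lemma measure_cap {d : ℕ} (t : ℝ) {a : E d} (ha : ‖a‖ = 1) :
    (sphereMeasure d {w | t < ⟪w, a⟫}).toReal = V d t := by
  rw [← integral_ind t ha]
  have hm : MeasurableSet {w : E d | t < ⟪w, a⟫} :=
    measurableSet_lt measurable_const (by fun_prop)
  have e : (fun w => ind t a w) = {w : E d | t < ⟪w, a⟫}.indicator (fun _ => (1 : ℝ)) := by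
    funext w
    simp only [ind, Set.indicator, Set.mem_ofPred_eq, real_inner_comm]
  rw [e, integral_indicator_const _ hm]
  simp [Measure.real]

lemma ae_norm_prod (d : ℕ) : ∀ᵐ p ∂((sphereMeasure d).prod (sphereMeasure d)),
    ‖p.1‖ = 1 ∧ ‖p.2‖ = 1 := by
  filter_upwards [Measure.quasiMeasurePreserving_fst.ae (ae_norm d),
    Measure.quasiMeasurePreserving_snd.ae (ae_norm d)] with p h1 h2
  exact ⟨h1, h2⟩

lemma integrable_prod_abs (d : ℕ) (v : E d) :
    Integrable (fun p : E d × E d => |⟪v, p.1 - p.2⟫|)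
      ((sphereMeasure d).prod (sphereMeasure d)) := by
  refine Integrable.of_bound (C := ‖v‖ * 2) (by fun_prop) ?_
  filter_upwards [ae_norm_prod d] with p hp
  rw [Real.norm_eq_abs, abs_abs]
  refine (abs_real_inner_le_norm v _).trans ?_
  gcongr
  refine (norm_sub_le _ _).trans ?_
  rw [hp.1, hp.2]; norm_num

lemma V_sq_aux {d : ℕ} {v : E d} (hv : ‖v‖ = 1) :
    ∫ t in Set.Icc (-1 : ℝ) 1, V d t ^ 2 =
      1 - (∫ p, |⟪v, p.1 - p.2⟫| ∂((sphereMeasure d).prod (sphereMeasure d))) / 2 := by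
  have e : (fun t => V d t ^ 2) = fun t => ∫ p : E d × E d, ind t v p.1 * ind t v p.2
      ∂((sphereMeasure d).prod (sphereMeasure d)) := by
    funext t
    rw [integral_prod_mul (fun w => ind t v w) (fun w => ind t v w), integral_ind t hv, sq]
  rw [e, integral_integral_swap]
  · have : ∀ᵐ p ∂((sphereMeasure d).prod (sphereMeasure d)),
        (∫ t in Set.Icc (-1 : ℝ) 1, ind t v p.1 * ind t v p.2) =
        1 + (⟪v, p.1⟫ + ⟪v, p.2⟫ - |⟪v, p.1 - p.2⟫|) / 2 := by
      filter_upwards [ae_norm_prod d] with p hp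
      rw [integral_ind_ind hv hp.1 hv hp.2, inner_sub_right]
    have i1 : Integrable (fun p : E d × E d => ⟪v, p.1⟫)
        ((sphereMeasure d).prod (sphereMeasure d)) := (integrable_inner d v).comp_fst _
    have i2 : Integrable (fun p : E d × E d => ⟪v, p.2⟫)
        ((sphereMeasure d).prod (sphereMeasure d)) := (integrable_inner d v).comp_snd _
    have z1 : ∫ p : E d × E d, ⟪v, p.1⟫ ∂((sphereMeasure d).prod (sphereMeasure d)) = 0 := by
      rw [integral_prod _ i1]
      simp [integral_inner_zero]
    have z2 : ∫ p : E d × E d, ⟪v, p.2⟫ ∂((sphereMeasure d).prod (sphereMeasure d)) = 0 := by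
      rw [integral_prod _ i2]
      simp [integral_inner_zero]
    rw [integral_congr_ae this, integral_add (integrable_const _), integral_div, integral_sub,
      integral_add i1 i2, z1, z2]
    · simp; ring
    · exact i1.add i2
    · exact integrable_prod_abs d v
    · exact ((i1.add i2).sub (integrable_prod_abs d v)).div_const _
  · refine Integrable.of_bound (C := 1) ?_ (Filter.Eventually.of_forall fun p => ?_)
    · exact ((measurable_ind_comp measurable_fst measurable_const
        (measurable_fst.comp measurable_snd)).mul
        (measurable_ind_comp measurable_fst measurable_const
        (measurable_snd.comp measurable_snd))).aestronglyMeasurable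
    · exact norm_ind_mul_le _ _ _ _ _

lemma V_sq (d : ℕ) :
    ∫ t in Set.Icc (-1 : ℝ) 1, V d t ^ 2 =
      1 - cst d / 2 * ∫ a, ∫ b, ‖a - b‖ ∂(sphereMeasure d) ∂(sphereMeasure d) := by
  set J := ∫ t in Set.Icc (-1 : ℝ) 1, V d t ^ 2 with hJ
  have h1 : ∀ᵐ v ∂(sphereMeasure d),
      (∫ p, |⟪v, p.1 - p.2⟫| ∂((sphereMeasure d).prod (sphereMeasure d))) = 2 - 2 * J := by
    filter_upwards [ae_norm d] with v hv
    rw [hJ, V_sq_aux hv]; ring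
  have h2 : ∫ v, (∫ p, |⟪v, p.1 - p.2⟫| ∂((sphereMeasure d).prod (sphereMeasure d)))
      ∂(sphereMeasure d) = 2 - 2 * J := by
    rw [integral_congr_ae h1]; simp
  rw [integral_integral_swap] at h2
  · have h3 : ∀ v : E d, ∫ z, |⟪z, v⟫| ∂(sphereMeasure d) = cst d * ‖v‖ := by
      intro v
      rw [← integral_abs_inner]
      simp only [real_inner_comm]
    simp only [h3] at h2
    rw [integral_const_mul, integral_prod] at h2
    · linarith
    · refine Integrable.of_bound (C := 2) (by fun_prop) ?_
      filter_upwards [ae_norm_prod d] with p hp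
      rw [norm_norm]
      refine (norm_sub_le _ _).trans ?_
      rw [hp.1, hp.2]; norm_num
  · refine Integrable.of_bound (C := 2) ?_ ?_
    · have : Continuous (Function.uncurry fun (v : E d) (p : E d × E d) => |⟪v, p.1 - p.2⟫|) := by
        unfold Function.uncurry
        fun_prop
      exact this.aestronglyMeasurable
    · filter_upwards [Measure.quasiMeasurePreserving_fst.ae (ae_norm d),
        Measure.quasiMeasurePreserving_snd.ae (ae_norm_prod d)] with q h1 h2
      simp only [Function.uncurry, Real.norm_eq_abs, abs_abs]
      refine (abs_real_inner_le_norm _ _).trans ?_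
      rw [h1, one_mul]
      refine (norm_sub_le _ _).trans ?_
      rw [h2.1, h2.2]; norm_num

lemma integrable_ind_mul {d : ℕ} (t : ℝ) (a b : E d) :
    Integrable (fun z => ind t a z * ind t b z) (sphereMeasure d) := by
  refine Integrable.of_bound (C := 1) ?_ (Filter.Eventually.of_forall fun p => ?_)
  · exact ((measurable_ind_comp measurable_const measurable_const measurable_id).mul
      (measurable_ind_comp measurable_const measurable_const measurable_id)).aestronglyMeasurable
  · exact norm_ind_mul_le _ _ _ _ _

lemma integrable_ind {d : ℕ} (t : ℝ) (a : E d) :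
    Integrable (fun z => ind t a z) (sphereMeasure d) := by
  refine (integrable_ind_mul t a a).congr (Filter.Eventually.of_forall fun z => ?_)
  simp [ind]

lemma slice {d N : ℕ} (hN : 0 < N) (x : Fin N → E d) (hx : ∀ i, ‖x i‖ = 1) (t : ℝ) :
    ∫ z, ((N : ℝ)⁻¹ * ∑ j : Fin N, (if t < ⟪x j, z⟫ then (1 : ℝ) else 0) -
        (sphereMeasure d {w | t < ⟪w, z⟫}).toReal) ^ 2 ∂(sphereMeasure d) =
    ((N : ℝ) ^ 2)⁻¹ * (∑ i : Fin N, ∑ j : Fin N,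
      ∫ z, ind t (x i) z * ind t (x j) z ∂(sphereMeasure d)) - V d t ^ 2 := by
  have hN' : (N : ℝ) ≠ 0 := by positivity
  have h : ∀ᵐ z ∂(sphereMeasure d),
      ((N : ℝ)⁻¹ * ∑ j : Fin N, (if t < ⟪x j, z⟫ then (1 : ℝ) else 0) -
        (sphereMeasure d {w | t < ⟪w, z⟫}).toReal) ^ 2 =
      ((N : ℝ) ^ 2)⁻¹ * (∑ i : Fin N, ∑ j : Fin N, ind t (x i) z * ind t (x j) z) -
        2 * V d t * (N : ℝ)⁻¹ * (∑ j : Fin N, ind t (x j) z) + V d t ^ 2 := by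
    filter_upwards [ae_norm d] with z hz
    rw [measure_cap t hz, ← Finset.sum_mul_sum]
    simp only [ind]
    field_simp
    ring
  have i1 : Integrable (fun z => ∑ i : Fin N, ∑ j : Fin N, ind t (x i) z * ind t (x j) z)
      (sphereMeasure d) :=
    integrable_finsetSum _ fun i _ => integrable_finsetSum _ fun j _ => integrable_ind_mul _ _ _
  have i2 : Integrable (fun z => ∑ j : Fin N, ind t (x j) z) (sphereMeasure d) :=
    integrable_finsetSum _ fun j _ => integrable_ind _ _
  have i3 : Integrable (fun z =>
      ((N : ℝ) ^ 2)⁻¹ * (∑ i : Fin N, ∑ j : Fin N, ind t (x i) z * ind t (x j) z) -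
        2 * V d t * (N : ℝ)⁻¹ * (∑ j : Fin N, ind t (x j) z)) (sphereMeasure d) :=
    (i1.const_mul _).sub (i2.const_mul _)
  rw [integral_congr_ae h, integral_add i3 (integrable_const _), integral_sub (i1.const_mul _) (i2.const_mul _), integral_const_mul,
    integral_const_mul, integral_finsetSum _ (fun j _ => integrable_ind _ _),
    integral_finsetSum _ (fun i _ => integrable_finsetSum _ fun j _ => integrable_ind_mul _ _ _)]
  simp only [integral_ind t (hx _), integral_finsetSum _ (fun j _ => integrable_ind_mul _ _ _)]
  simp
  field_simp
  ring

lemma integrable_kernel {d : ℕ} (a b : E d) :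
    Integrable (fun t => ∫ z, ind t a z * ind t b z ∂(sphereMeasure d))
      (volume.restrict (Set.Icc (-1 : ℝ) 1)) := by
  have : Integrable (fun q : ℝ × E d => ind q.1 a q.2 * ind q.1 b q.2)
      ((volume.restrict (Set.Icc (-1 : ℝ) 1)).prod (sphereMeasure d)) := by
    refine Integrable.of_bound (C := 1) ?_ (Filter.Eventually.of_forall fun p => ?_)
    · exact ((measurable_ind_comp measurable_fst measurable_const measurable_snd).mul
        (measurable_ind_comp measurable_fst measurable_const measurable_snd)).aestronglyMeasurable
    · exact norm_ind_mul_le _ _ _ _ _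
  exact this.integral_prod_left

lemma integrable_V_sq (d : ℕ) :
    Integrable (fun t => V d t ^ 2) (volume.restrict (Set.Icc (-1 : ℝ) 1)) := by
  have : Integrable (fun q : ℝ × (E d × E d) => ind q.1 (pole d) q.2.1 * ind q.1 (pole d) q.2.2)
      ((volume.restrict (Set.Icc (-1 : ℝ) 1)).prod
        ((sphereMeasure d).prod (sphereMeasure d))) := by
    refine Integrable.of_bound (C := 1) ?_ (Filter.Eventually.of_forall fun p => ?_)
    · exact ((measurable_ind_comp measurable_fst measurable_const
        (measurable_fst.comp measurable_snd)).mul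
        (measurable_ind_comp measurable_fst measurable_const
        (measurable_snd.comp measurable_snd))).aestronglyMeasurable
    · exact norm_ind_mul_le _ _ _ _ _
  refine this.integral_prod_left.congr (Filter.Eventually.of_forall fun t => ?_)
  show (∫ p : E d × E d, ind t (pole d) p.1 * ind t (pole d) p.2
      ∂((sphereMeasure d).prod (sphereMeasure d))) = V d t ^ 2
  rw [integral_prod_mul (fun w => ind t (pole d) w) (fun w => ind t (pole d) w), sq, V]

lemma subst_cos (g : ℝ → ℝ) :
    ∫ θ in (0 : ℝ)..Real.pi, g (Real.cos θ) * Real.sin θ = ∫ t in Set.Icc (-1 : ℝ) 1, g t := by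
  have h := integral_image_eq_integral_abs_deriv_smul (s := Set.Icc 0 Real.pi) (f := Real.cos)
    (f' := fun θ => -Real.sin θ) measurableSet_Icc
    (fun θ _ => (Real.hasDerivAt_cos θ).hasDerivWithinAt) Real.injOn_cos g
  rw [Real.bijOn_cos.image_eq] at h
  rw [h, intervalIntegral.integral_of_le Real.pi_pos.le, ← integral_Icc_eq_integral_Ioc]
  refine setIntegral_congr_fun measurableSet_Icc fun θ hθ => ?_
  simp only [abs_neg, smul_eq_mul]
  rw [abs_of_nonneg (Real.sin_nonneg_of_mem_Icc hθ), mul_comm]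

lemma discrepancy_eq {d N : ℕ} (hN : 0 < N) (x : Fin N → E d) (hx : ∀ i, ‖x i‖ = 1) :
    capL2DiscrepancySq d N x =
      cst d / 2 * (∫ a, ∫ b, ‖a - b‖ ∂(sphereMeasure d) ∂(sphereMeasure d)) -
      cst d / 2 * (((N : ℝ) ^ 2)⁻¹ * (∑ i : Fin N, ∑ j : Fin N, ‖x i - x j‖)) := by
  have hN' : (N : ℝ) ≠ 0 := by positivity
  unfold capL2DiscrepancySq
  simp only [slice hN x hx]
  rw [subst_cos (fun t => ((N : ℝ) ^ 2)⁻¹ * (∑ i : Fin N, ∑ j : Fin N,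
      ∫ z, ind t (x i) z * ind t (x j) z ∂(sphereMeasure d)) - V d t ^ 2)]
  rw [integral_sub _ (integrable_V_sq d), V_sq, integral_const_mul, integral_finsetSum]
  · have : ∀ i, ∫ t in Set.Icc (-1 : ℝ) 1, ∑ j : Fin N,
        ∫ z, ind t (x i) z * ind t (x j) z ∂(sphereMeasure d) =
        ∑ j : Fin N, (1 - cst d / 2 * ‖x i - x j‖) := by
      intro i
      rw [integral_finsetSum _ (fun j _ => integrable_kernel _ _)]
      exact Finset.sum_congr rfl fun j _ => kernel_integral (hx i) (hx j)
    simp only [this, Finset.sum_sub_distrib, ← Finset.mul_sum]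
    simp
    field_simp
    ring
  · exact fun i _ => integrable_finsetSum _ fun j _ => integrable_kernel _ _
  · exact (integrable_finsetSum _ fun i _ =>
      integrable_finsetSum _ fun j _ => integrable_kernel _ _).const_mul _

end Stolarsky

/-- Stolarsky's invariance principle: there is a constant `C_d > 0` such that
for every `N`-point set `X_N ⊂ S^d`,
`(1/N²) Σ_{i,j} ‖x_i - x_j‖ + (1/C_d) [D_{L²}(X_N)]² = ∫∫ ‖x - y‖ dσ_d dσ_d`. -/
theorem stolarsky_invariance_principle (d : ℕ) (hd : 1 ≤ d) :
    ∃ C : ℝ, 0 < C ∧ ∀ N : ℕ, 0 < N →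
      ∀ x : Fin N → EuclideanSpace ℝ (Fin (d + 1)), (∀ i, ‖x i‖ = 1) →
        ((N : ℝ) ^ 2)⁻¹ * (∑ i : Fin N, ∑ j : Fin N, ‖x i - x j‖) +
            C⁻¹ * capL2DiscrepancySq d N x =
          ∫ a, ∫ b, ‖a - b‖ ∂(sphereMeasure d) ∂(sphereMeasure d) := by
  refine ⟨Stolarsky.cst d / 2, half_pos (Stolarsky.cst_pos d), fun N hN x hx => ?_⟩
  rw [Stolarsky.discrepancy_eq hN x hx]
  have hc := (Stolarsky.cst_pos d).ne'
  field_simp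
  ring
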